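/- arXiv:1211.1728 — 2 statements merged into one kernel-verified Lean document; each statement's English description precedes it below -/
import Mathlib

section
/- Let n ≥ 3 and M = n·⌊(n-1)/2⌋. For every m with n ≤ m ≤ M and m ∉ {M-1, M-2}, there exists a connected simple graph on n vertices with exactly m edges in which every vertex has even degree (i.e., an eulerian graph of order n and size m). -/
/-- The (cyclic) pair-distance between two vectors of length `n`,
with coordinates indexed by `ZMod n`. -/
noncomputable def pairDist {n : ℕ} {σ : Type*} (u v : ZMod n → σ) : ℕ :=
  {i : ZMod n | (u i, u (i + 1)) ≠ (v i, v (i + 1))}.ncard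

/-- The Hamming distance between two vectors of length `n`,
with coordinates indexed by `ZMod n`. -/
noncomputable def hamDist {n : ℕ} {σ : Type*} (u v : ZMod n → σ) : ℕ :=
  {i : ZMod n | u i ≠ v i}.ncard

namespace Euler7

/-- The graph whose edges are `{i, i+d}` for `P i d`. -/
def gr (n : ℕ) (P : ZMod n → ℕ → Prop) (hP : ∀ i d, P i d → 1 ≤ d ∧ 2 * d < n) :
    SimpleGraph (ZMod n) where
  Adj x y := ∃ d : ℕ, (P x d ∧ y = x + d) ∨ (P y d ∧ x = y + d)
  symm := ⟨by
    rintro x y ⟨d, h⟩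
    exact ⟨d, h.symm⟩⟩
  loopless := ⟨by
    rintro x ⟨d, h⟩
    have h' : P x d ∧ x = x + d := by tauto
    obtain ⟨h1, h2⟩ := hP x d h'.1
    have h3 : (d : ZMod n) = 0 := by simpa using h'.2
    rw [ZMod.natCast_eq_zero_iff] at h3
    have := Nat.le_of_dvd (by omega) h3
    omega⟩

lemma cast_inj {n a b : ℕ} (ha : a < n) (hb : b < n) (h : (a : ZMod n) = b) : a = b := by
  rw [ZMod.natCast_eq_natCast_iff] at h
  exact Nat.ModEq.eq_of_lt_of_lt h ha hb

lemma add_ne {n a b : ℕ} (ha : 1 ≤ a ∧ 2 * a < n) (hb : 1 ≤ b ∧ 2 * b < n)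
    (h : (a : ZMod n) + b = 0) : False := by
  rw [← Nat.cast_add, ZMod.natCast_eq_zero_iff] at h
  have := Nat.le_of_dvd (by omega) h
  omega

open Classical in
lemma edges (n : ℕ) [NeZero n] (P : ZMod n → ℕ → Prop)
    (hP : ∀ i d, P i d → 1 ≤ d ∧ 2 * d < n) :
    (gr n P hP).edgeSet.ncard = ∑ i : ZMod n, ((Finset.range n).filter (P i)).card := by
  have h : (gr n P hP).edgeSet = (fun p : (Σ _ : ZMod n, ℕ) => s(p.1, p.1 + (p.2 : ZMod n))) ''
      ((Finset.univ.sigma fun i : ZMod n => (Finset.range n).filter (P i) : Finset _) : Set _) := by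
    ext e
    induction e using Sym2.ind with
    | _ x y =>
      simp only [SimpleGraph.mem_edgeSet, Set.mem_image, Finset.mem_coe, Finset.mem_sigma,
        Finset.mem_univ, Finset.mem_filter, Finset.mem_range, true_and]
      constructor
      · rintro ⟨d, ⟨h, rfl⟩ | ⟨h, rfl⟩⟩
        · exact ⟨⟨x, d⟩, ⟨by have := hP _ _ h; show d < n; omega, h⟩, rfl⟩
        · exact ⟨⟨y, d⟩, ⟨by have := hP _ _ h; show d < n; omega, h⟩, Sym2.eq_swap⟩
      · rintro ⟨⟨i, d⟩, ⟨h1, h2⟩, h3⟩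
        simp only [Sym2.eq_iff] at h3
        rcases h3 with ⟨rfl, rfl⟩ | ⟨rfl, rfl⟩
        · exact ⟨d, Or.inl ⟨h2, rfl⟩⟩
        · exact ⟨d, Or.inr ⟨h2, rfl⟩⟩
  rw [h, Set.InjOn.ncard_image, Set.ncard_coe_finset, Finset.card_sigma]
  rintro ⟨i, d⟩ h1 ⟨j, e⟩ h2 h3
  simp only [Finset.mem_coe, Finset.mem_sigma,
        Finset.mem_univ, Finset.mem_filter, Finset.mem_range, true_and] at h1 h2
  simp only [Sym2.eq_iff] at h3
  rcases h3 with ⟨rfl, h3⟩ | ⟨h3, h4⟩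
  · have := cast_inj h1.1 h2.1 (add_left_cancel h3)
    subst this; rfl
  · exfalso
    refine add_ne (hP _ _ h1.2) (hP _ _ h2.2) ?_
    rw [h3] at h4
    linear_combination h4

open Classical in
lemma degs (n : ℕ) [NeZero n] (P : ZMod n → ℕ → Prop)
    (hP : ∀ i d, P i d → 1 ≤ d ∧ 2 * d < n) (x : ZMod n) :
    ((gr n P hP).neighborSet x).ncard = ((Finset.range n).filter (P x)).card
      + ((Finset.range n).filter (fun d : ℕ => P (x - d) d)).card := by
  have h : (gr n P hP).neighborSet x =
      (fun d : ℕ => x + (d : ZMod n)) '' (((Finset.range n).filter (P x) : Finset ℕ) : Set ℕ) ∪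
      (fun d : ℕ => x - (d : ZMod n)) ''
        (((Finset.range n).filter (fun d : ℕ => P (x - d) d) : Finset ℕ) : Set ℕ) := by
    ext y
    simp only [SimpleGraph.mem_neighborSet, Set.mem_union, Set.mem_image, Finset.mem_coe,
        Finset.mem_filter, Finset.mem_range]
    constructor
    · rintro ⟨d, ⟨h, rfl⟩ | ⟨h, rfl⟩⟩
      · exact Or.inl ⟨d, ⟨by have := hP _ _ h; omega, h⟩, rfl⟩
      · exact Or.inr ⟨d, ⟨by have := hP _ _ h; omega, by simpa using h⟩, by simp⟩
    · rintro (⟨d, ⟨h1, h2⟩, rfl⟩ | ⟨d, ⟨h1, h2⟩, rfl⟩)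
      · exact ⟨d, Or.inl ⟨h2, rfl⟩⟩
      · exact ⟨d, Or.inr ⟨h2, by simp⟩⟩
  rw [h, Set.ncard_union_eq _ (Set.toFinite _) (Set.toFinite _), Set.InjOn.ncard_image,
    Set.InjOn.ncard_image, Set.ncard_coe_finset, Set.ncard_coe_finset]
  · intro a ha b hb hab
    simp only [Finset.mem_coe, Finset.mem_filter, Finset.mem_range] at ha hb
    exact cast_inj ha.1 hb.1 (sub_right_injective hab)
  · intro a ha b hb hab
    simp only [Finset.mem_coe, Finset.mem_filter, Finset.mem_range] at ha hb
    exact cast_inj ha.1 hb.1 (add_left_cancel hab)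
  · rw [Set.disjoint_left]
    rintro _ ⟨a, ha, rfl⟩ ⟨b, hb, hab⟩
    simp only [Finset.mem_coe, Finset.mem_filter, Finset.mem_range] at ha hb
    refine add_ne (hP _ _ ha.2) (hP _ _ hb.2) ?_
    simp only at hab
    linear_combination -hab

lemma conn {V : Type*} (G : SimpleGraph V) (f : V → ℕ) (r : V)
    (h : ∀ x, x ≠ r → ∃ y, G.Adj x y ∧ f y < f x) : G.Connected := by
  have key : ∀ k x, f x = k → G.Reachable x r := by
    intro k
    induction k using Nat.strong_induction_on with
    | _ k ih =>
      intro x hx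
      by_cases hr : x = r
      · subst hr; exact SimpleGraph.Reachable.refl _
      · obtain ⟨y, hy, hlt⟩ := h x hr
        exact hy.reachable.trans (ih (f y) (hx ▸ hlt) y rfl)
  have : Nonempty V := ⟨r⟩
  exact ⟨fun x y => (key _ x rfl).trans (key _ y rfl).symm⟩

lemma val_add (n : ℕ) [NeZero n] (x : ZMod n) (d : ℕ) (hd : d < n) :
    (x + (d : ZMod n)).val = if x.val + d < n then x.val + d else x.val + d - n := by
  have hx := ZMod.val_lt x
  rw [ZMod.val_add, ZMod.val_natCast, Nat.mod_eq_of_lt hd]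
  split_ifs with h
  · exact Nat.mod_eq_of_lt h
  · rw [Nat.mod_eq_sub_mod (by omega), Nat.mod_eq_of_lt (by omega)]

lemma val_sub (n : ℕ) [NeZero n] (x : ZMod n) (d : ℕ) (hd : d < n) :
    (x - (d : ZMod n)).val = if d ≤ x.val then x.val - d else x.val + n - d := by
  have h := val_add n (x - d) d hd
  have hx := ZMod.val_lt x
  have hx := ZMod.val_lt (x - (d : ZMod n))
  rw [sub_add_cancel] at h
  split_ifs at h ⊢ <;> omega

open Classical in
lemma sum_val (n : ℕ) [NeZero n] (g : ℕ → ℕ) :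
    ∑ i : ZMod n, g i.val = ∑ i ∈ Finset.range n, g i := by
  obtain _ | n := n
  · exact absurd rfl (NeZero.ne 0)
  · exact Fin.sum_univ_eq_sum_range g (n + 1)

open Classical in
lemma count (n q : ℕ) (a b c : Prop) (Q : ℕ → Prop) (hn : 3 ≤ n) (hq : q < n)
    (hc : c → 7 ≤ n)
    (hQ : ∀ d, Q d ↔ (d = 1 ∧ a) ∨ (d = 2 ∧ b) ∨ (d = 3 ∧ c) ∨ (4 ≤ d ∧ d ≤ q)) :
    ((Finset.range n).filter Q).card =
      (if a then 1 else 0) + (if b then 1 else 0) + (if c then 1 else 0) + (q - 3) := by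
  have h : (Finset.range n).filter Q = (if a then {1} else ∅) ∪ ((if b then {2} else ∅) ∪
      ((if c then {3} else ∅) ∪ Finset.Icc 4 q)) := by
    ext d
    simp only [Finset.mem_filter, Finset.mem_range, hQ, Finset.mem_union, Finset.mem_Icc]
    split_ifs <;> simp_all <;> omega
  rw [h, Finset.card_union_of_disjoint, Finset.card_union_of_disjoint,
    Finset.card_union_of_disjoint]
  · split_ifs <;> simp <;> omega
  all_goals
    rw [Finset.disjoint_left]
    intro d
    split_ifs <;> simp <;> omega

open Classical in
/-- Master construction. -/
lemma master (n q : ℕ) (A B C : ℕ → Prop) (f : ℕ → ℕ) (hn : 3 ≤ n) (hq : 2 * q < n)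
    (hB : ∀ i, B i → 5 ≤ n) (hC : ∀ i, C i → 7 ≤ n)
    (hev : ∀ x < n, Even ((if A x then 1 else 0) + (if B x then 1 else 0) + (if C x then 1 else 0)
      + (if A (if 1 ≤ x then x - 1 else x + n - 1) then 1 else 0)
      + (if B (if 2 ≤ x then x - 2 else x + n - 2) then 1 else 0)
      + (if C (if 3 ≤ x then x - 3 else x + n - 3) then 1 else 0)))
    (hcon : ∀ x < n - 1, (A x ∧ f (x + 1) < f x) ∨
      (B x ∧ f (if x + 2 < n then x + 2 else x + 2 - n) < f x) ∨
      (x = 0 ∧ A (n - 1) ∧ f (n - 1) < f 0)) :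
    ∃ G : SimpleGraph (Fin n), G.Connected ∧
      G.edgeSet.ncard = ((Finset.range n).filter A).card + ((Finset.range n).filter B).card
        + ((Finset.range n).filter C).card + n * (q - 3) ∧
      ∀ x, Even ((G.neighborSet x).ncard) := by
  have : NeZero n := ⟨by omega⟩
  suffices h : ∃ G : SimpleGraph (ZMod n), G.Connected ∧
      G.edgeSet.ncard = ((Finset.range n).filter A).card + ((Finset.range n).filter B).card
        + ((Finset.range n).filter C).card + n * (q - 3) ∧
      ∀ x, Even ((G.neighborSet x).ncard) by
    obtain _ | n := n
    · omega
    · exact h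
  let P : ZMod n → ℕ → Prop := fun i d =>
    (d = 1 ∧ A i.val) ∨ (d = 2 ∧ B i.val) ∨ (d = 3 ∧ C i.val) ∨ (4 ≤ d ∧ d ≤ q)
  have hP : ∀ i d, P i d → 1 ≤ d ∧ 2 * d < n := by
    rintro i d (⟨rfl, h⟩ | ⟨rfl, h⟩ | ⟨rfl, h⟩ | h)
    · omega
    · have := hB _ h; omega
    · have := hC _ h; omega
    · omega
  refine ⟨gr n P hP, ?_, ?_, ?_⟩
  · refine conn _ (fun x => f x.val) ((n - 1 : ℕ) : ZMod n) ?_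
    intro x hx
    have hxv := ZMod.val_lt x
    have hne : x.val ≠ n - 1 := by
      intro h
      apply hx
      rw [← h, ZMod.natCast_zmod_val]
    rcases hcon x.val (by omega) with ⟨h1, h2⟩ | ⟨h1, h2⟩ | ⟨h0, h1, h2⟩
    · refine ⟨x + (1 : ℕ), ⟨1, Or.inl ⟨Or.inl ⟨rfl, h1⟩, rfl⟩⟩, ?_⟩
      rw [val_add n x 1 (by omega), if_pos (by omega)]
      exact h2
    · refine ⟨x + (2 : ℕ), ⟨2, Or.inl ⟨Or.inr (Or.inl ⟨rfl, h1⟩), rfl⟩⟩, ?_⟩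
      rw [val_add n x 2 (by omega)]
      exact h2
    · have hv : (x - (1 : ℕ)).val = n - 1 := by
        rw [val_sub n x 1 (by omega), if_neg (by omega)]; omega
      refine ⟨x - (1 : ℕ), ⟨1, Or.inr ⟨Or.inl ⟨rfl, by rw [hv]; exact h1⟩, by simp⟩⟩, ?_⟩
      rw [hv, h0]
      exact h2
  · rw [edges]
    rw [Finset.sum_congr rfl (fun i _ => count n q (A i.val) (B i.val) (C i.val) (P i) hn
      (by omega) (hC _) (fun d => Iff.rfl))]
    rw [sum_val n (fun i => (if A i then 1 else 0) + (if B i then 1 else 0) +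
      (if C i then 1 else 0) + (q - 3))]
    simp only [Finset.sum_add_distrib, Finset.card_filter, Finset.sum_const, Finset.card_range,
      smul_eq_mul]
  · intro x
    rw [degs, count n q (A x.val) (B x.val) (C x.val) (P x) hn (by omega) (hC _)
      (fun d => Iff.rfl),
      count n q (A (x - (1 : ℕ)).val) (B (x - (2 : ℕ)).val) (C (x - (3 : ℕ)).val) _ hn
        (by omega) (hC _) (by
          intro d
          constructor
          · rintro (⟨rfl, h⟩ | ⟨rfl, h⟩ | ⟨rfl, h⟩ | h) <;> tauto
          · rintro (⟨rfl, h⟩ | ⟨rfl, h⟩ | ⟨rfl, h⟩ | h)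
            · exact Or.inl ⟨rfl, h⟩
            · exact Or.inr (Or.inl ⟨rfl, h⟩)
            · exact Or.inr (Or.inr (Or.inl ⟨rfl, h⟩))
            · exact Or.inr (Or.inr (Or.inr h)))]
    have h := hev x.val (ZMod.val_lt x)
    have hC3 : (if C (x - (3 : ℕ)).val then 1 else 0) =
        (if C (if 3 ≤ x.val then x.val - 3 else x.val + n - 3) then 1 else 0) := by
      by_cases h7 : 7 ≤ n
      · rw [val_sub n x 3 (by omega)]
      · rw [if_neg (fun h => h7 (hC _ h)), if_neg (fun h => h7 (hC _ h))]
    rw [hC3, val_sub n x 1 (by omega), val_sub n x 2 (by omega)]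
    have h' := h.add (Even.add_self (q - 3))
    rw [Nat.even_iff] at h' ⊢
    omega

lemma card_ne2 (n a b : ℕ) (h : a ≠ b) (ha : a < n) (hb : b < n) (A : ℕ → Prop) [DecidablePred A]
    (hA : ∀ i, A i ↔ i ≠ a ∧ i ≠ b) : ((Finset.range n).filter A).card = n - 2 := by
  have : (Finset.range n).filter A = ((Finset.range n).erase a).erase b := by
    ext i
    simp only [Finset.mem_filter, Finset.mem_range, hA, Finset.mem_erase]
    tauto
  rw [this, Finset.card_erase_of_mem, Finset.card_erase_of_mem, Finset.card_range]
  · omega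
  · simpa using ha
  · simp [hb, h.symm]

lemma card_ne1 (n a : ℕ) (ha : a < n) (A : ℕ → Prop) [DecidablePred A]
    (hA : ∀ i, A i ↔ i ≠ a) : ((Finset.range n).filter A).card = n - 1 := by
  have : (Finset.range n).filter A = (Finset.range n).erase a := by
    ext i
    simp only [Finset.mem_filter, Finset.mem_range, hA, Finset.mem_erase]
    tauto
  rw [this, Finset.card_erase_of_mem, Finset.card_range]
  simpa using ha

lemma card_const (n : ℕ) (p : Prop) [Decidable p] :
    ((Finset.range n).filter (fun _ => p)).card = if p then n else 0 := by
  split_ifs with h <;> simp [h]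

/-- `q` full classes. -/
lemma case_full (n q : ℕ) (hn : 3 ≤ n) (h1 : 1 ≤ q) (hq : 2 * q < n) :
    ∃ G : SimpleGraph (Fin n), G.Connected ∧ G.edgeSet.ncard = n * q ∧
      ∀ x, Even ((G.neighborSet x).ncard) := by
  classical
  obtain ⟨G, hG, he, hd⟩ := master n q (fun _ => True) (fun _ => 2 ≤ q) (fun _ => 3 ≤ q)
    (fun x => n - x) hn hq (fun _ h => by omega) (fun _ h => by omega)
    (by intro x hx; rw [Nat.even_iff]; split_ifs <;> simp)
    (by intro x hx; left; exact ⟨trivial, by omega⟩)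
  refine ⟨G, hG, ?_, hd⟩
  rw [he, card_const, card_const, card_const]
  obtain _ | _ | _ | q := q
  · omega
  · simp
  · simp; ring
  · simp; ring

/-- `q` classes minus a cycle of length `r`. -/
lemma case_cycle (n q r : ℕ) (h1 : 2 ≤ q) (hq : 2 * q < n) (hr : 3 ≤ r) (hrn : r ≤ n) :
    ∃ G : SimpleGraph (Fin n), G.Connected ∧ G.edgeSet.ncard = n * q - r ∧
      ∀ x, Even ((G.neighborSet x).ncard) := by
  classical
  obtain ⟨G, hG, he, hd⟩ := master n q (fun i => i ≠ 0 ∧ i ≠ r - 2) (fun i => r - 2 ≤ i)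
    (fun _ => 3 ≤ q)
    (fun x => if x = 0 then 1 else 2 * (n - 1 - x)) (by omega) hq (fun _ h => by omega)
    (fun _ h => by omega)
    (by intro x hx; rw [Nat.even_iff]; split_ifs <;> omega)
    (by
      intro x hx
      by_cases h0 : x = 0
      · right; right
        refine ⟨h0, by omega, ?_⟩
        split_ifs <;> omega
      by_cases h2 : x = r - 2
      · right; left
        refine ⟨by omega, ?_⟩
        split_ifs <;> omega
      · left
        refine ⟨⟨h0, h2⟩, ?_⟩
        split_ifs <;> omega)
  refine ⟨G, hG, ?_, hd⟩
  have hB : ((Finset.range n).filter (fun i => r - 2 ≤ i)).card = n - (r - 2) := by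
    rw [← Nat.card_Ico (r - 2) n]
    apply congrArg Finset.card
    ext i
    simp only [Finset.mem_filter, Finset.mem_range, Finset.mem_Ico]
    tauto
  have he' : G.edgeSet.ncard = ((Finset.range n).filter (fun i => i ≠ 0 ∧ i ≠ r - 2)).card
      + ((Finset.range n).filter (fun i => r - 2 ≤ i)).card
      + ((Finset.range n).filter (fun _i => 3 ≤ q)).card + n * (q - 3) := by
    convert he
  rw [he', card_ne2 n 0 (r - 2) (by omega) (by omega) (by omega) _ (fun i => Iff.rfl),
    card_const, hB]
  obtain _ | _ | _ | q := q
  · omega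
  · omega
  · simp; omega
  · rw [if_pos (by omega), show q + 1 + 1 + 1 - 3 = q by omega]
    simp only [Nat.mul_add]
    omega

/-- size `n * q - 1`. -/
lemma case_one (n q : ℕ) (h1 : 2 ≤ q) (hq : 2 * (q + 1) < n) :
    ∃ G : SimpleGraph (Fin n), G.Connected ∧ G.edgeSet.ncard = n * q - 1 ∧
      ∀ x, Even ((G.neighborSet x).ncard) := by
  classical
  obtain ⟨G, hG, he, hd⟩ := master n (q + 1) (fun i => i ≠ 0) (fun i => i = 1)
    (fun i => i ≠ 0)
    (fun x => n - x) (by omega) hq (fun _ h => by omega)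
    (fun _ h => by omega)
    (by intro x hx; rw [Nat.even_iff]; split_ifs <;> omega)
    (by
      intro x hx
      by_cases h0 : x = 0
      · right; right
        exact ⟨h0, by omega, by omega⟩
      · left
        exact ⟨h0, by omega⟩)
  refine ⟨G, hG, ?_, hd⟩
  have hB : ((Finset.range n).filter (fun i => i = 1)).card = 1 := by
    rw [Finset.card_eq_one]
    refine ⟨1, ?_⟩
    ext i
    simp only [Finset.mem_filter, Finset.mem_range, Finset.mem_singleton]
    omega
  have he' : G.edgeSet.ncard = ((Finset.range n).filter (fun i => i ≠ 0)).card
      + ((Finset.range n).filter (fun i => i = 1)).card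
      + ((Finset.range n).filter (fun _i => _i ≠ 0)).card + n * (q + 1 - 3) := by
    convert he
  rw [he', card_ne1 n 0 (by omega) _ (fun i => Iff.rfl), hB]
  obtain ⟨q, rfl⟩ := Nat.exists_eq_add_of_le h1
  rw [show 2 + q + 1 - 3 = q by omega, Nat.mul_add]
  omega

/-- size `n * q - 2`. -/
lemma case_two (n q : ℕ) (h1 : 2 ≤ q) (hq : 2 * (q + 1) < n) :
    ∃ G : SimpleGraph (Fin n), G.Connected ∧ G.edgeSet.ncard = n * q - 2 ∧
      ∀ x, Even ((G.neighborSet x).ncard) := by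
  classical
  obtain ⟨G, hG, he, hd⟩ := master n (q + 1) (fun i => i ≠ 0 ∧ i ≠ 1) (fun i => i = 1 ∨ i = 2)
    (fun i => i ≠ 0 ∧ i ≠ 1)
    (fun x => n - x) (by omega) hq (fun _ h => by omega)
    (fun _ h => by omega)
    (by intro x hx; rw [Nat.even_iff]; split_ifs <;> omega)
    (by
      intro x hx
      by_cases h0 : x = 0
      · right; right
        exact ⟨h0, by omega, by omega⟩
      by_cases h2 : x = 1
      · right; left
        refine ⟨by omega, ?_⟩
        split_ifs <;> omega
      · left
        exact ⟨⟨h0, h2⟩, by omega⟩)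
  refine ⟨G, hG, ?_, hd⟩
  have hB : ((Finset.range n).filter (fun i => i = 1 ∨ i = 2)).card = 2 := by
    rw [Finset.card_eq_two]
    refine ⟨1, 2, by omega, ?_⟩
    ext i
    simp only [Finset.mem_filter, Finset.mem_range, Finset.mem_singleton, Finset.mem_insert]
    omega
  have he' : G.edgeSet.ncard = ((Finset.range n).filter (fun i => i ≠ 0 ∧ i ≠ 1)).card
      + ((Finset.range n).filter (fun i => i = 1 ∨ i = 2)).card
      + ((Finset.range n).filter (fun _i => _i ≠ 0 ∧ _i ≠ 1)).card + n * (q + 1 - 3) := by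
    convert he
  rw [he', card_ne2 n 0 1 (by omega) (by omega) (by omega) _ (fun i => Iff.rfl), hB]
  obtain ⟨q, rfl⟩ := Nat.exists_eq_add_of_le h1
  rw [show 2 + q + 1 - 3 = q by omega, Nat.mul_add]
  omega

end Euler7

/-- eulerian graphs of order n and any admissible size m. -/
theorem stmt_7 (n m : ℕ) (hn : 3 ≤ n) (hm : n ≤ m) (hM : m ≤ n * ((n - 1) / 2))
    (h1 : m ≠ n * ((n - 1) / 2) - 1) (h2 : m ≠ n * ((n - 1) / 2) - 2) :
    ∃ G : SimpleGraph (Fin n), G.Connected ∧ G.edgeSet.ncard = m ∧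
      ∀ x, Even ((G.neighborSet x).ncard) := by
  obtain ⟨q, r, hr, hqr⟩ : ∃ q r, r < n ∧ m + r = n * q := by
    have hdm := Nat.div_add_mod m n
    have hlt := Nat.mod_lt m (show n > 0 by omega)
    by_cases h0 : m % n = 0
    · exact ⟨m / n, 0, by omega, by omega⟩
    · exact ⟨m / n + 1, n - m % n, by omega, by rw [Nat.mul_add]; omega⟩
  have hq1 : 1 ≤ q := by
    rcases Nat.eq_zero_or_pos q with h | h
    · subst h; omega
    · exact h
  have hqh : q ≤ (n - 1) / 2 := by
    by_contra hcon
    have h3 : n * ((n - 1) / 2 + 1) ≤ n * q := Nat.mul_le_mul_left n (by omega)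
    rw [Nat.mul_add] at h3
    omega
  have hq2 : r ≠ 0 → 2 ≤ q := by
    intro h0
    by_contra hcon
    have : q = 1 := by omega
    subst this
    omega
  have hlt : q = (n - 1) / 2 → r ≠ 1 ∧ r ≠ 2 := by
    intro h
    rw [← h] at h1 h2
    omega
  have hm' : m = n * q - r := by omega
  rw [hm']
  by_cases r0 : r = 0
  · subst r0
    exact Euler7.case_full n q hn hq1 (by omega)
  by_cases r1 : r = 1
  · subst r1
    exact Euler7.case_one n q (by omega) (by omega)
  by_cases r2 : r = 2
  · subst r2
    exact Euler7.case_two n q (by omega) (by omega)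
  · exact Euler7.case_cycle n q r (by omega) (by omega) (by omega) (by omega)
end

section
/- Define M(n) = 2⌊n²/8⌋ if n is even and M(n) = 2⌊(n-1)²/8⌋ + 1 if n is odd. Let n ≥ 6. Then for every m with m ≡ n (mod 2) and n ≤ m ≤ M(n), except m = M(n) - 2 when n ≥ 8, there exists a connected simple graph on n vertices with exactly m edges, all degrees even, and girth at least 4 (i.e., containing no triangle). -/
/-- M(n) = 2⌊n²/8⌋ for n even, and 2⌊(n-1)²/8⌋ + 1 for n odd. -/
def Mg (n : ℕ) : ℕ := if Even n then 2 * (n ^ 2 / 8) else 2 * ((n - 1) ^ 2 / 8) + 1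

/-- existence of a connected triangle-free even graph of order n and size m -/
def PG (n m : ℕ) : Prop :=
  ∃ (V : Type) (_ : Finite V) (G : SimpleGraph V), Nat.card V = n ∧ G.Connected ∧
    G.edgeSet.ncard = m ∧ (∀ x, Even ((G.neighborSet x).ncard)) ∧
    (∀ x y z, G.Adj x y → G.Adj y z → G.Adj x z → False)

lemma PG.toFin {n m : ℕ} (h : PG n m) :
    ∃ G : SimpleGraph (Fin n), G.Connected ∧ G.edgeSet.ncard = m ∧
      (∀ x, Even ((G.neighborSet x).ncard)) ∧ (4 : ℕ∞) ≤ G.egirth := by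
  obtain ⟨V, _, G, hc, hconn, hm, hdeg, htri⟩ := h
  let e : V ≃ Fin n := Finite.equivFinOfCardEq hc
  let i : G.comap e.symm ≃g G := SimpleGraph.Iso.comap e.symm G
  refine ⟨G.comap e.symm, i.connected_iff.2 hconn, ?_, ?_, ?_⟩
  · rw [← hm]
    exact Nat.card_congr i.mapEdgeSet
  · intro x
    have := hdeg (i x)
    have h2 : ((G.comap e.symm).neighborSet x).ncard = (G.neighborSet (i x)).ncard :=
      Nat.card_congr (i.mapNeighborSet x)
    rw [h2]; exact this
  · rw [SimpleGraph.le_egirth]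
    intro a w hw
    have h3 := hw.three_le_length
    by_contra hlt
    have hlt' : w.length < 4 := by
      by_contra hh
      apply hlt
      exact_mod_cast (not_lt.1 hh)
    have h4 : w.length = 3 := by omega
    obtain ⟨s, hs⟩ := (SimpleGraph.is3Clique_iff_exists_cycle_length_three (G := G.comap e.symm)).2
      ⟨a, w, hw, h4⟩
    rw [SimpleGraph.is3Clique_iff] at hs
    obtain ⟨x, y, z, h1, h2, h3, -⟩ := hs
    exact htri _ _ _ h1 h3 h2

/-- subdividing an edge -/
def subdiv {V : Type} (G : SimpleGraph V) (u v : V) : SimpleGraph (Option V) where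
  Adj x y := match x, y with
    | none, none => False
    | none, some y => y = u ∨ y = v
    | some x, none => x = u ∨ x = v
    | some x, some y => G.Adj x y ∧ ¬ ((x = u ∧ y = v) ∨ (x = v ∧ y = u))
  symm := ⟨by
    rintro (_ | x) (_ | y) h
    · exact h
    · exact h
    · exact h
    · exact ⟨h.1.symm, fun hh => h.2 (by tauto)⟩⟩
  loopless := ⟨by
    rintro (_ | x) h
    · exact h
    · exact G.loopless.irrefl _ h.1⟩

lemma PG.succ {n m : ℕ} (h : PG n m) (hm0 : 0 < m) : PG (n + 1) (m + 1) := by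
  obtain ⟨V, _, G, hc, hconn, hm, hdeg, htri⟩ := h
  have hne : G.edgeSet.Nonempty := by
    rw [← Set.ncard_pos]; omega
  obtain ⟨e, he⟩ := hne
  induction e using Sym2.ind with
  | _ u v =>
  have huv : G.Adj u v := he
  have hne : u ≠ v := huv.ne
  refine ⟨Option V, inferInstance, subdiv G u v, ?_, ?_, ?_, ?_, ?_⟩
  · rw [Finite.card_option, hc]
  · have hu : (subdiv G u v).Adj none (some u) := Or.inl rfl
    have hv : (subdiv G u v).Adj none (some v) := Or.inr rfl
    have hstep : ∀ x y, G.Adj x y → (subdiv G u v).Reachable (some x) (some y) := by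
      intro x y hxy
      by_cases hh : (x = u ∧ y = v) ∨ (x = v ∧ y = u)
      · rcases hh with ⟨rfl, rfl⟩ | ⟨rfl, rfl⟩
        · exact hu.reachable.symm.trans hv.reachable
        · exact hv.reachable.symm.trans hu.reachable
      · have : (subdiv G u v).Adj (some x) (some y) := ⟨hxy, hh⟩
        exact this.reachable
    have hr : ∀ x y, G.Reachable x y → (subdiv G u v).Reachable (some x) (some y) := by
      rintro x y ⟨w⟩
      induction w with
      | nil => exact SimpleGraph.Reachable.refl _
      | cons h _ ih => exact (hstep _ _ h).trans ih
    have hn : ∀ x, (subdiv G u v).Reachable none x := by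
      rintro (_ | x)
      · exact SimpleGraph.Reachable.refl _
      · exact hu.reachable.trans (hr _ _ (hconn.preconnected u x))
    haveI : Nonempty (Option V) := ⟨none⟩
    exact SimpleGraph.Connected.mk (fun x y => (hn x).symm.trans (hn y))
  · have hE : (subdiv G u v).edgeSet =
        insert s(none, some u) (insert s(none, some v)
          (Sym2.map some '' (G.edgeSet \ {s(u, v)}))) := by
      ext e
      induction e using Sym2.ind with
      | _ x y =>
      constructor
      · intro h
        have h : (subdiv G u v).Adj x y := h
        rcases x with _ | x <;> rcases y with _ | y
        · exact h.elim
        · rcases h with rfl | rfl <;> simp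
        · rcases h with rfl | rfl <;> simp
        · right; right
          refine ⟨s(x, y), ⟨h.1, ?_⟩, rfl⟩
          have := h.2
          simpa using this
      · rintro (h | h | ⟨e, ⟨h1, h2⟩, h3⟩)
        · rw [h]; exact Or.inl rfl
        · rw [h]; exact Or.inr rfl
        · induction e using Sym2.ind with
          | _ a b =>
          rw [← h3]
          exact ⟨h1, by simpa using h2⟩
    rw [hE, Set.ncard_insert_of_notMem, Set.ncard_insert_of_notMem,
      Set.ncard_image_of_injective _ (Sym2.map.injective (Option.some_injective V)),
      Set.ncard_diff_singleton_of_mem he, hm]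
    · omega
    · rintro ⟨e, -, h⟩
      induction e using Sym2.ind with
      | _ a b => simp at h
    · rintro (h | ⟨e, -, h⟩)
      · simp at h; exact hne h
      · induction e using Sym2.ind with
        | _ a b => simp at h
  · have key : ∀ a b, G.Adj a b → ∀ (S : Set (Option V)),
        S = insert none (some '' (G.neighborSet a \ {b})) → Even S.ncard := by
      intro a b hab S hS
      have hb : b ∈ G.neighborSet a := hab
      have hpos : 0 < (G.neighborSet a).ncard := (Set.ncard_pos).2 ⟨b, hb⟩
      rw [hS, Set.ncard_insert_of_notMem (by simp),
        Set.ncard_image_of_injective _ (Option.some_injective V),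
        Set.ncard_diff_singleton_of_mem hb, Nat.sub_add_cancel hpos]
      exact hdeg a
    rintro (_ | x)
    · have : (subdiv G u v).neighborSet none = {some u, some v} := by
        ext y
        rcases y with _ | y
        · simp [subdiv]
        · simp [subdiv]
      rw [this, Set.ncard_pair (by simpa using hne)]
      exact even_two
    · by_cases hxu : x = u
      · subst hxu
        apply key x v huv
        ext y
        rcases y with _ | y
        · simp [subdiv]
        · simp [subdiv, hne]
      · by_cases hxv : x = v
        · subst hxv
          apply key x u huv.symm
          ext y
          rcases y with _ | y
          · simp [subdiv]
          · simp [subdiv, hne.symm]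
        · have : (subdiv G u v).neighborSet (some x) = some '' (G.neighborSet x) := by
            ext y
            rcases y with _ | y
            · simp [subdiv, hxu, hxv]
            · simp [subdiv, hxu, hxv]
          rw [this, Set.ncard_image_of_injective _ (Option.some_injective V)]
          exact hdeg x
  · have hnn : ∀ x y, (subdiv G u v).Adj none x → (subdiv G u v).Adj none y →
        (subdiv G u v).Adj x y → False := by
      rintro (_ | x) (_ | y) h1 h2 h3
      · exact h1
      · exact h1
      · exact h2
      · have hl := G.loopless.irrefl x
        rcases h1 with rfl | rfl <;> rcases h2 with rfl | rfl
        · exact hl h3.1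
        · exact h3.2 (Or.inl ⟨rfl, rfl⟩)
        · exact h3.2 (Or.inr ⟨rfl, rfl⟩)
        · exact hl h3.1
    rintro (_ | x) (_ | y) (_ | z) h1 h2 h3
    · exact h1
    · exact h1
    · exact h3
    · exact hnn _ _ h1 h3 h2
    · exact h2
    · exact hnn _ _ h1.symm h2 h3
    · exact hnn _ _ h3.symm h2.symm h1
    · exact htri _ _ _ h1.1 h2.1 h3.1

/-- bipartite graph of a relation -/
def bip {A B : Type} (R : A → B → Prop) : SimpleGraph (A ⊕ B) where
  Adj x y := match x, y with
    | Sum.inl i, Sum.inr j => R i j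
    | Sum.inr j, Sum.inl i => R i j
    | _, _ => False
  symm := ⟨by rintro (x | x) (y | y) h <;> exact h⟩
  loopless := ⟨by rintro (x | x) h <;> exact h⟩

lemma PG.bip {p q m : ℕ} (R : Fin p → Fin q → Prop) (hrow : ∀ i, Even {j | R i j}.ncard)
    (hcol : ∀ j, Even {i | R i j}.ncard) (hm : ∑ j, {i | R i j}.ncard = m)
    (i₀ : Fin p) (j₀ : Fin q) (hi₀ : ∀ j, R i₀ j) (hj₀ : ∀ i, R i j₀) : PG (p + q) m := by
  refine ⟨Fin p ⊕ Fin q, inferInstance, _root_.bip R, by simp, ?_, ?_, ?_, ?_⟩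
  · have h1 : ∀ j, (_root_.bip R).Adj (Sum.inl i₀) (Sum.inr j) := fun j => hi₀ j
    have h2 : ∀ i, (_root_.bip R).Adj (Sum.inr j₀) (Sum.inl i) := fun i => hj₀ i
    have hn : ∀ x, (_root_.bip R).Reachable (Sum.inl i₀) x := by
      rintro (i | j)
      · exact (h1 j₀).reachable.trans (h2 i).reachable
      · exact (h1 j).reachable
    haveI : Nonempty (Fin p ⊕ Fin q) := ⟨Sum.inl i₀⟩
    exact SimpleGraph.Connected.mk (fun x y => (hn x).symm.trans (hn y))
  · have hE : (_root_.bip R).edgeSet =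
        (fun x : (Σ _ : Fin q, Fin p) => s(Sum.inl x.2, Sum.inr x.1)) '' {x | R x.2 x.1} := by
      ext e
      induction e using Sym2.ind with
      | _ x y =>
      constructor
      · intro h
        have h : (_root_.bip R).Adj x y := h
        rcases x with i | j <;> rcases y with i' | j'
        · exact h.elim
        · exact ⟨⟨j', i⟩, h, rfl⟩
        · exact ⟨⟨j, i'⟩, h, Sym2.eq_swap⟩
        · exact h.elim
      · rintro ⟨x, h1, h2⟩
        rw [← h2]
        exact h1
    rw [hE, Set.ncard_image_of_injective]
    · rw [← hm]
      have e : ({x | R x.2 x.1} : Set (Σ _ : Fin q, Fin p)) ≃ (Σ j : Fin q, {i | R i j}) :=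
        { toFun := fun x => ⟨x.1.1, x.1.2, x.2⟩
          invFun := fun x => ⟨⟨x.1, x.2.1⟩, x.2.2⟩
          left_inv := fun x => rfl
          right_inv := fun x => rfl }
      have := Nat.card_congr e
      rw [Nat.card_sigma] at this
      exact this
    · rintro ⟨j, i⟩ ⟨j', i'⟩ h
      simp at h
      simp [h]
  · rintro (i | j)
    · have : (_root_.bip R).neighborSet (Sum.inl i) = Sum.inr '' {j | R i j} := by
        ext (y | y) <;> simp [_root_.bip]
      rw [this, Set.ncard_image_of_injective _ Sum.inr_injective]
      exact hrow i
    · have : (_root_.bip R).neighborSet (Sum.inr j) = Sum.inl '' {i | R i j} := by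
        ext (y | y) <;> simp [_root_.bip]
      rw [this, Set.ncard_image_of_injective _ Sum.inl_injective]
      exact hcol j
  · rintro (x | x) (y | y) (z | z) h1 h2 h3 <;> first | exact h1 | exact h2 | exact h3

/-- removed pairs -/
def Nrel (s i c : ℕ) : Prop :=
  c < s ∧ (if s % 2 = 0 then i < 2 else
    (c = 0 ∧ (i = 0 ∨ i = 2)) ∨ (c = 1 ∧ i < 2) ∨ (c = 2 ∧ (i = 1 ∨ i = 2)) ∨ (3 ≤ c ∧ i < 2))

lemma ncard_compl_of {p k : ℕ} (R : Fin p → Prop) (F : Finset ℕ) (hF : ∀ x ∈ F, x < p)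
    (h : ∀ i : Fin p, R i ↔ (i : ℕ) ∉ F) (hk : F.card = k) : {i | R i}.ncard = p - k := by
  have h1 : Fin.val '' {i | R i} = ((Finset.range p \ F : Finset ℕ) : Set ℕ) := by
    ext x
    constructor
    · rintro ⟨i, hi, rfl⟩
      have := (h i).1 hi
      simp [this]
    · intro hx
      simp at hx
      exact ⟨⟨x, hx.1⟩, (h _).2 hx.2, rfl⟩
  rw [← Set.ncard_image_of_injective _ Fin.val_injective, h1, Set.ncard_coe_finset,
    Finset.card_sdiff_of_subset (fun x hx => by simpa using hF x hx), hk, Finset.card_range]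

lemma PG.dense {a b s : ℕ} (ha : 1 ≤ a) (hs : s = 0 ∨ (2 ≤ a ∧ 2 ≤ s)) (hsb : s < 2 * b) :
    PG (2 * a + 2 * b) (4 * a * b - 2 * s) := by
  have hcolc : ∀ j : Fin (2 * b), {i : Fin (2 * a) | ¬ Nrel s i j}.ncard =
      2 * a - if (j : ℕ) < s then 2 else 0 := by
    intro j
    by_cases hj : (j : ℕ) < s
    · have hs2 : 2 ≤ a := by omega
      rw [if_pos hj]
      by_cases he : s % 2 = 0
      · exact ncard_compl_of _ {0, 1} (by simp; omega) (by intro i; simp [Nrel, hj, he]; omega) rfl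
      · by_cases h0 : (j : ℕ) = 0
        · exact ncard_compl_of _ {0, 2} (by simp; omega)
            (by intro i; simp [Nrel, he, h0]; omega) rfl
        · by_cases h2 : (j : ℕ) = 2
          · exact ncard_compl_of _ {1, 2} (by simp; omega)
              (by intro i; simp [Nrel, he, h2]; omega) rfl
          · exact ncard_compl_of _ {0, 1} (by simp; omega)
              (by intro i; simp [Nrel, he, h2, h0, hj]; omega) rfl
    · rw [if_neg hj]
      exact ncard_compl_of _ ∅ (by simp) (by intro i; simp [Nrel, hj]) rfl
  have hrowc : ∀ i : Fin (2 * a), ∃ k, Even k ∧ k ≤ 2 * b ∧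
      {j : Fin (2 * b) | ¬ Nrel s i j}.ncard = 2 * b - k := by
    intro i
    by_cases he : s % 2 = 0
    · by_cases hi : (i : ℕ) < 2
      · exact ⟨s, Nat.even_iff.2 he, by omega, ncard_compl_of _ (Finset.range s) (by simp; omega)
          (by intro j; simp [Nrel, he, hi]) (by simp)⟩
      · exact ⟨0, by simp, by omega, ncard_compl_of _ ∅ (by simp)
          (by intro j; simp [Nrel, he, hi]) rfl⟩
    · have hs3 : 3 ≤ s := by omega
      have hev : Even (s - 1) := by rw [Nat.even_iff]; omega
      by_cases h0 : (i : ℕ) = 0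
      · refine ⟨s - 1, hev, by omega, ncard_compl_of _ ((Finset.range s).erase 2)
          (by simp; omega) (by intro j; simp [Nrel, he, h0]; omega) ?_⟩
        rw [Finset.card_erase_of_mem (by simp; omega), Finset.card_range]
      · by_cases h1 : (i : ℕ) = 1
        · refine ⟨s - 1, hev, by omega, ncard_compl_of _ ((Finset.range s).erase 0)
            (by simp; omega) (by intro j; simp [Nrel, he, h1]; omega) ?_⟩
          rw [Finset.card_erase_of_mem (by simp; omega), Finset.card_range]
        · by_cases h2 : (i : ℕ) = 2
          · exact ⟨2, by simp, by omega, ncard_compl_of _ {0, 2}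
              (by simp; omega) (by intro j; simp [Nrel, he, h2]; omega) rfl⟩
          · exact ⟨0, by simp, by omega, ncard_compl_of _ ∅
              (by simp) (by intro j; simp [Nrel, he, h0, h1, h2]; omega) rfl⟩
  have hfull : ∃ i₀ : Fin (2 * a), ∀ j : Fin (2 * b), ¬ Nrel s i₀ j := by
    rcases hs with rfl | ⟨h2, hs2⟩
    · exact ⟨⟨0, by omega⟩, fun j => by simp [Nrel]⟩
    · exact ⟨⟨3, by omega⟩, fun j => by simp [Nrel]⟩
  obtain ⟨i₀, hi₀⟩ := hfull
  refine PG.bip (fun i j => ¬ Nrel s i j) ?_ ?_ ?_ i₀ ⟨s, hsb⟩ hi₀ (fun i => by simp [Nrel])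
  · intro i
    obtain ⟨k, hk, hkb, h⟩ := hrowc i
    rw [h]
    rw [Nat.even_iff] at *
    omega
  · intro j
    rw [hcolc j, Nat.even_iff]
    split_ifs <;> omega
  · rw [Finset.sum_congr rfl (fun j _ => hcolc j)]
    have h1 : ∑ j : Fin (2 * b), (2 * a - if (j : ℕ) < s then 2 else 0) + 2 * s = 4 * a * b := by
      have h2 : ∑ j : Fin (2 * b), (if (j : ℕ) < s then 2 else 0) = 2 * s := by
        rw [Fin.sum_univ_eq_sum_range (fun j => if j < s then 2 else 0), ← Finset.sum_filter]
        have : (Finset.range (2 * b)).filter (· < s) = Finset.range s := by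
          ext x; simp; omega
        rw [this]; simp [mul_comm]
      rw [← h2, ← Finset.sum_add_distrib]
      rw [Finset.sum_congr rfl (fun j _ => Nat.sub_add_cancel (by split_ifs <;> omega))]
      simp; ring
    omega

/-- half-order maximal size -/
def Mh (k : ℕ) : ℕ := if k % 2 = 0 then k * k else k * k - 1

lemma Mg_even (k : ℕ) : Mg (2 * k) = Mh k := by
  unfold Mg Mh
  rw [if_pos (by simp)]
  have h1 : (2 * k) ^ 2 = 4 * (k * k) := by ring
  rw [h1]
  have : (k * k) % 2 = (k % 2) * (k % 2) % 2 := Nat.mul_mod _ _ _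
  rcases Nat.mod_two_eq_zero_or_one k with h | h <;> simp [h] at this ⊢ <;> omega

lemma PG.even (k : ℕ) (hk : 3 ≤ k) : ∀ m, m % 2 = 0 → 2 * k ≤ m → m ≤ Mh k →
    ¬ (4 ≤ k ∧ m = Mh k - 2) → PG (2 * k) m := by
  induction k, hk using Nat.le_induction with
  | base =>
    intro m h1 h2 h3 _
    have h3 : m ≤ 8 := h3
    have : m = 6 ∨ m = 8 := by omega
    rcases this with rfl | rfl
    · have := PG.dense (a := 1) (b := 1) (s := 0) (by omega) (by omega) (by omega)
      exact (this.succ (by omega)).succ (by omega)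
    · exact PG.dense (a := 1) (b := 2) (s := 0) (by omega) (by omega) (by omega)
  | succ k hk ih =>
    intro m h1 h2 h3 h4
    by_cases hA : m ≤ Mh k + 2 ∧ ¬ (4 ≤ k ∧ m = Mh k)
    · obtain ⟨hA, hB⟩ := hA
      have := ih (m - 2) (by omega) (by omega) (by omega) (by omega)
      have := (this.succ (by omega)).succ (by omega)
      have e : m = m - 2 + 1 + 1 := by omega
      rw [e]
      exact this
    · rcases Nat.even_or_odd' k with ⟨t, rfl | rfl⟩
      · -- new half-order is odd: parts 2t and 2t+2
        have e1 : Mh (2 * t) = 4 * (t * t) := by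
          unfold Mh; rw [if_pos (by omega)]; ring
        have e2 : Mh (2 * t + 1) = 4 * (t * t) + 4 * t := by
          unfold Mh; rw [if_neg (by omega)]
          have : (2 * t + 1) * (2 * t + 1) = 4 * (t * t) + 4 * t + 1 := by ring
          omega
        rw [e1] at hA
        rw [e2] at h3 h4
        obtain ⟨s, hs⟩ : ∃ s, m + 2 * s = 4 * (t * t) + 4 * t :=
          ⟨(4 * (t * t) + 4 * t - m) / 2, by omega⟩
        have := PG.dense (a := t) (b := t + 1) (s := s) (by omega) (by omega) (by omega)
        have e3 : 4 * t * (t + 1) = 4 * (t * t) + 4 * t := by ring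
        rw [e3] at this
        convert this using 1 <;> omega
      · -- new half-order 2t+2
        have e1 : Mh (2 * t + 1) = 4 * (t * t) + 4 * t := by
          unfold Mh; rw [if_neg (by omega)]
          have : (2 * t + 1) * (2 * t + 1) = 4 * (t * t) + 4 * t + 1 := by ring
          omega
        have e2 : Mh (2 * t + 1 + 1) = 4 * (t * t) + 8 * t + 4 := by
          unfold Mh; rw [if_pos (by omega)]; ring
        rw [e1] at hA
        rw [e2] at h3 h4
        by_cases hB : m = 4 * (t * t) + 4 * t
        · have := PG.dense (a := t) (b := t + 2) (s := 2 * t) (by omega) (by omega) (by omega)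
          have e3 : 4 * t * (t + 2) = 4 * (t * t) + 8 * t := by ring
          rw [e3] at this
          convert this using 1 <;> omega
        · obtain ⟨s, hs⟩ : ∃ s, m + 2 * s = 4 * (t * t) + 8 * t + 4 :=
            ⟨(4 * (t * t) + 8 * t + 4 - m) / 2, by omega⟩
          have := PG.dense (a := t + 1) (b := t + 1) (s := s) (by omega) (by omega) (by omega)
          have e3 : 4 * (t + 1) * (t + 1) = 4 * (t * t) + 8 * t + 4 := by ring
          rw [e3] at this
          convert this using 1 <;> omega

/-- eulerian graphs of order n, girth at least four, and
any admissible size m of the same parity as n. -/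
theorem stmt_8 (n m : ℕ) (hn : 6 ≤ n) (hpar : m % 2 = n % 2)
    (hnm : n ≤ m) (hmM : m ≤ Mg n) (hexc : ¬(8 ≤ n ∧ m = Mg n - 2)) :
    ∃ G : SimpleGraph (Fin n), G.Connected ∧ G.edgeSet.ncard = m ∧
      (∀ x, Even ((G.neighborSet x).ncard)) ∧ (4 : ℕ∞) ≤ G.egirth := by
  apply PG.toFin
  rcases Nat.even_or_odd' n with ⟨k, rfl | rfl⟩
  · rw [Mg_even] at hmM hexc
    exact PG.even k (by omega) m (by omega) hnm hmM (by omega)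
  · have e : Mg (2 * k + 1) = Mg (2 * k) + 1 := by
      simp [Mg]
    rw [e, Mg_even] at hmM hexc
    have := PG.even k (by omega) (m - 1) (by omega) (by omega) (by omega) (by omega)
    have h2 := this.succ (by omega)
    have e : m = m - 1 + 1 := by omega
    rw [e]
    exact h2
end
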